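/- Let u be a smooth axially symmetric solution of the stationary Navier–Stokes system (ASNS) with smooth axially symmetric pressure p, where u and p are defined on all of ℝ³ and are 2π-periodic in z, u(x) → 0 uniformly as r = |x'| → ∞, and ∫_{−π}^{π}∫₀^∞ |∇u|² r dr dz < ∞. Then there is a constant C such that |∂_z p(r,z)| ≤ C for all (r,z), and for every R > 1, every r ∈ [R, 2R] and every z ∈ [−π, π], the pressure oscillation satisfies |p(r,z) − p(R,z)| ≤ C. -/

import Mathlib

open MeasureTheory Real

/-- `∂_r f` for a function `f = f(r,z)`. -/
noncomputable def pdr (f : ℝ → ℝ → ℝ) (r z : ℝ) : ℝ := deriv (fun s => f s z) r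

/-- `∂_z f` for a function `f = f(r,z)`. -/
noncomputable def pdz (f : ℝ → ℝ → ℝ) (r z : ℝ) : ℝ := deriv (fun t => f r t) z

/-- The axially symmetric stationary Navier–Stokes system (ASNS), imposed for all
`r > 0` and all `z ∈ S`. -/
def ASNS (ur uθ uz p : ℝ → ℝ → ℝ) (S : Set ℝ) : Prop :=
  ∀ r : ℝ, 0 < r → ∀ z ∈ S,
    ((ur r z * pdr ur r z + uz r z * pdz ur r z) - (uθ r z) ^ 2 / r + pdr p r z
        = pdr (pdr ur) r z + (1 / r) * pdr ur r z + pdz (pdz ur) r z - ur r z / r ^ 2)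
    ∧ ((ur r z * pdr uθ r z + uz r z * pdz uθ r z) + ur r z * uθ r z / r
        = pdr (pdr uθ) r z + (1 / r) * pdr uθ r z + pdz (pdz uθ) r z - uθ r z / r ^ 2)
    ∧ ((ur r z * pdr uz r z + uz r z * pdz uz r z) + pdz p r z
        = pdr (pdr uz) r z + (1 / r) * pdr uz r z + pdz (pdz uz) r z)
    ∧ (pdr ur r z + ur r z / r + pdz uz r z = 0)

/-- The Dirichlet integrand `|∇u|²` of an axially symmetric field. -/
noncomputable def dirE (ur uθ uz : ℝ → ℝ → ℝ) (r z : ℝ) : ℝ :=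
  (pdr ur r z) ^ 2 + (pdz ur r z) ^ 2 + (pdr uθ r z) ^ 2 + (pdz uθ r z) ^ 2
    + (pdr uz r z) ^ 2 + (pdz uz r z) ^ 2 + ((ur r z) ^ 2 + (uθ r z) ^ 2) / r ^ 2

namespace PO

/-- Joint smoothness. -/
def Sm (f : ℝ → ℝ → ℝ) : Prop := ContDiff ℝ (⊤ : ℕ∞) (fun q : ℝ × ℝ => f q.1 q.2)

/-- Periodicity in `z`. -/
def Per (f : ℝ → ℝ → ℝ) : Prop := ∀ r z : ℝ, f r (z + 2 * π) = f r z

theorem Sm.fd {f : ℝ → ℝ → ℝ} (hf : Sm f) (q : ℝ × ℝ) :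
    HasFDerivAt (fun q : ℝ × ℝ => f q.1 q.2) (fderiv ℝ (fun q : ℝ × ℝ => f q.1 q.2) q) q :=
  (hf.differentiable (by simp)).differentiableAt.hasFDerivAt

theorem Sm.hr' {f : ℝ → ℝ → ℝ} (hf : Sm f) (r z : ℝ) :
    HasDerivAt (fun s => f s z) (fderiv ℝ (fun q : ℝ × ℝ => f q.1 q.2) (r, z) (1, 0)) r :=
  (hf.fd (r, z)).comp_hasDerivAt (f := fun s : ℝ => (s, z)) r
    ((hasDerivAt_id r).prodMk (hasDerivAt_const r z))

theorem Sm.hz' {f : ℝ → ℝ → ℝ} (hf : Sm f) (r z : ℝ) :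
    HasDerivAt (fun t => f r t) (fderiv ℝ (fun q : ℝ × ℝ => f q.1 q.2) (r, z) (0, 1)) z :=
  (hf.fd (r, z)).comp_hasDerivAt (f := fun t : ℝ => (r, t)) z
    ((hasDerivAt_const z r).prodMk (hasDerivAt_id z))

theorem Sm.pdr_eq {f : ℝ → ℝ → ℝ} (hf : Sm f) (r z : ℝ) :
    pdr f r z = fderiv ℝ (fun q : ℝ × ℝ => f q.1 q.2) (r, z) (1, 0) := (hf.hr' r z).deriv

theorem Sm.pdz_eq {f : ℝ → ℝ → ℝ} (hf : Sm f) (r z : ℝ) :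
    pdz f r z = fderiv ℝ (fun q : ℝ × ℝ => f q.1 q.2) (r, z) (0, 1) := (hf.hz' r z).deriv

theorem Sm.hr {f : ℝ → ℝ → ℝ} (hf : Sm f) (r z : ℝ) :
    HasDerivAt (fun s => f s z) (pdr f r z) r := by
  rw [hf.pdr_eq]; exact hf.hr' r z

theorem Sm.hz {f : ℝ → ℝ → ℝ} (hf : Sm f) (r z : ℝ) :
    HasDerivAt (fun t => f r t) (pdz f r z) z := by
  rw [hf.pdz_eq]; exact hf.hz' r z

theorem Sm.fderiv_app {f : ℝ → ℝ → ℝ} (hf : Sm f) (v : ℝ × ℝ) :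
    ContDiff ℝ (⊤ : ℕ∞) (fun q : ℝ × ℝ => fderiv ℝ (fun q : ℝ × ℝ => f q.1 q.2) q v) := by
  have h : ContDiff ℝ (⊤ : ℕ∞) (fderiv ℝ (fun q : ℝ × ℝ => f q.1 q.2)) :=
    ContDiff.fderiv_right (m := (⊤ : ℕ∞)) (n := (⊤ : ℕ∞)) hf (by simp)
  exact h.clm_apply contDiff_const

theorem Sm.pdr {f : ℝ → ℝ → ℝ} (hf : Sm f) : Sm (pdr f) := by
  have := hf.fderiv_app (1, 0)
  unfold Sm
  simp_rw [hf.pdr_eq]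
  exact this

theorem Sm.pdz {f : ℝ → ℝ → ℝ} (hf : Sm f) : Sm (pdz f) := by
  have := hf.fderiv_app (0, 1)
  unfold Sm
  simp_rw [hf.pdz_eq]
  exact this

theorem Sm.comm {f : ℝ → ℝ → ℝ} (hf : Sm f) (r z : ℝ) :
    _root_.pdr (_root_.pdz f) r z = _root_.pdz (_root_.pdr f) r z := by
  have hs : IsSymmSndFDerivAt ℝ (fun q : ℝ × ℝ => f q.1 q.2) (r, z) :=
    (ContDiff.contDiffAt hf).isSymmSndFDerivAt (by simp; exact WithTop.coe_le_coe.2 le_top)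
  have h : ContDiff ℝ (⊤ : ℕ∞) (fderiv ℝ (fun q : ℝ × ℝ => f q.1 q.2)) :=
    ContDiff.fderiv_right (m := (⊤ : ℕ∞)) (n := (⊤ : ℕ∞)) hf (by simp)
  have hd : DifferentiableAt ℝ (fderiv ℝ (fun q : ℝ × ℝ => f q.1 q.2)) (r, z) :=
    (h.differentiable (by simp)).differentiableAt
  rw [hf.pdz.pdr_eq, hf.pdr.pdz_eq]
  simp_rw [hf.pdr_eq, hf.pdz_eq]
  rw [fderiv_clm_apply hd (by fun_prop), fderiv_clm_apply hd (by fun_prop)]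
  simp
  exact hs _ _

theorem Sm.cont {f : ℝ → ℝ → ℝ} (hf : Sm f) : Continuous (fun q : ℝ × ℝ => f q.1 q.2) :=
  ContDiff.continuous hf

theorem Sm.add {f g : ℝ → ℝ → ℝ} (hf : Sm f) (hg : Sm g) : Sm (fun r z => f r z + g r z) :=
  ContDiff.add hf hg
theorem Sm.sub {f g : ℝ → ℝ → ℝ} (hf : Sm f) (hg : Sm g) : Sm (fun r z => f r z - g r z) :=
  ContDiff.sub hf hg
theorem Sm.mul {f g : ℝ → ℝ → ℝ} (hf : Sm f) (hg : Sm g) : Sm (fun r z => f r z * g r z) :=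
  ContDiff.mul hf hg
theorem Sm.cmul {f : ℝ → ℝ → ℝ} (hf : Sm f) (c : ℝ) : Sm (fun r z => c * f r z) :=
  ContDiff.mul contDiff_const hf
theorem Sm.sq {f : ℝ → ℝ → ℝ} (hf : Sm f) : Sm (fun r z => (f r z) ^ 2) :=
  ContDiff.pow hf 2

theorem Per.pdr {f : ℝ → ℝ → ℝ} (hf : Per f) : Per (pdr f) := by
  intro r z
  unfold _root_.pdr
  congr 1
  funext s
  exact hf s z

theorem Per.pdz {f : ℝ → ℝ → ℝ} (hf : Per f) : Per (pdz f) := by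
  intro r z
  unfold _root_.pdz
  have : (fun t => f r t) = (fun t => f r (t + 2 * π)) := by funext t; exact (hf r t).symm
  conv_rhs => rw [this]
  rw [deriv_comp_add_const (f := fun t => f r t)]

/-- Integral over one period in `z`. -/
noncomputable def I (g : ℝ → ℝ → ℝ) (r : ℝ) : ℝ := ∫ z in (-π)..π, g r z

theorem cont_slice {g : ℝ → ℝ → ℝ} (hg : Continuous (fun q : ℝ × ℝ => g q.1 q.2)) (r : ℝ) :
    Continuous (g r) := hg.comp (by fun_prop : Continuous fun z : ℝ => (r, z))

theorem ii {g : ℝ → ℝ → ℝ} (hg : Continuous (fun q : ℝ × ℝ => g q.1 q.2)) (r a b : ℝ) :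
    IntervalIntegrable (g r) volume a b := (cont_slice hg r).intervalIntegrable _ _

theorem I_cont {g : ℝ → ℝ → ℝ} (hg : Continuous (fun q : ℝ × ℝ => g q.1 q.2)) :
    Continuous (I g) :=
  intervalIntegral.continuous_parametric_intervalIntegral_of_continuous' (f := g) hg _ _

theorem I_mono {g h : ℝ → ℝ → ℝ} (hg : Continuous (fun q : ℝ × ℝ => g q.1 q.2))
    (hh : Continuous (fun q : ℝ × ℝ => h q.1 q.2)) {r : ℝ} (H : ∀ z, g r z ≤ h r z) :
    I g r ≤ I h r :=
  intervalIntegral.integral_mono_on (by linarith [pi_pos]) (ii hg r _ _) (ii hh r _ _)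
    (fun z _ => H z)

theorem I_add {g h : ℝ → ℝ → ℝ} (hg : Continuous (fun q : ℝ × ℝ => g q.1 q.2))
    (hh : Continuous (fun q : ℝ × ℝ => h q.1 q.2)) (r : ℝ) :
    I (fun r z => g r z + h r z) r = I g r + I h r :=
  intervalIntegral.integral_add (ii hg r _ _) (ii hh r _ _)

theorem I_sub {g h : ℝ → ℝ → ℝ} (hg : Continuous (fun q : ℝ × ℝ => g q.1 q.2))
    (hh : Continuous (fun q : ℝ × ℝ => h q.1 q.2)) (r : ℝ) :
    I (fun r z => g r z - h r z) r = I g r - I h r :=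
  intervalIntegral.integral_sub (ii hg r _ _) (ii hh r _ _)

theorem I_cmul (g : ℝ → ℝ → ℝ) (c r : ℝ) :
    I (fun r z => c * g r z) r = c * I g r :=
  intervalIntegral.integral_const_mul _ _

theorem I_nonneg {g : ℝ → ℝ → ℝ} {r : ℝ} (H : ∀ z, 0 ≤ g r z) : 0 ≤ I g r :=
  intervalIntegral.integral_nonneg (by linarith [pi_pos]) (fun z _ => H z)

theorem I_pdz {T : ℝ → ℝ → ℝ} (hT : Sm T) (hP : Per T) (r : ℝ) : I (pdz T) r = 0 := by
  unfold I
  rw [intervalIntegral.integral_eq_sub_of_hasDerivAt (fun z _ => hT.hz r z) (ii hT.pdz.cont r _ _)]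
  have := hP r (-π)
  rw [show -π + 2 * π = π by ring] at this
  linarith

theorem I_deriv {g : ℝ → ℝ → ℝ} (hg : Sm g) (r : ℝ) : HasDerivAt (I g) (I (pdr g) r) r := by
  have hK : IsCompact (Set.Icc (r - 1) (r + 1) ×ˢ Set.Icc (-π) π) :=
    isCompact_Icc.prod isCompact_Icc
  obtain ⟨C, hC⟩ := hK.exists_bound_of_continuousOn hg.pdr.cont.continuousOn
  refine (intervalIntegral.hasDerivAt_integral_of_dominated_loc_of_deriv_le
    (F := g) (F' := pdr g) (bound := fun _ => C) (s := Set.Icc (r - 1) (r + 1))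
    (Icc_mem_nhds (by linarith) (by linarith)) ?_ (ii hg.cont r _ _) ?_ ?_ ?_ ?_).2
  · exact Filter.Eventually.of_forall fun x => (cont_slice hg.cont x).aestronglyMeasurable
  · exact (cont_slice hg.pdr.cont r).aestronglyMeasurable
  · refine Filter.Eventually.of_forall fun t ht x hx => ?_
    rw [Set.uIoc_of_le (by linarith [pi_pos])] at ht
    exact hC (x, t) ⟨hx, ht.1.le, ht.2⟩
  · exact intervalIntegrable_const
  · exact Filter.Eventually.of_forall fun t _ x _ => hg.hr x t

/-- Eventual boundedness. -/
def B (f : ℝ → ℝ → ℝ) : Prop := ∃ a K : ℝ, ∀ r, a ≤ r → ∀ z, |f r z| ≤ K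

/-- Uniformly local square integrability at infinity. -/
def U (f : ℝ → ℝ → ℝ) : Prop := ∃ G : ℝ → ℝ → ℝ, Continuous (fun q : ℝ × ℝ => G q.1 q.2) ∧
  ∃ a C : ℝ, (∀ r, a ≤ r → ∀ z, |f r z| ≤ G r z) ∧
    ∀ r, a ≤ r → ∫ s in r..(r + 1), I (fun r z => (G r z) ^ 2) s ≤ C

theorem sqc {g : ℝ → ℝ → ℝ} (hg : Continuous (fun q : ℝ × ℝ => g q.1 q.2)) :
    Continuous (fun q : ℝ × ℝ => (g q.1 q.2) ^ 2) := hg.pow 2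

theorem Isq_cont {g : ℝ → ℝ → ℝ} (hg : Continuous (fun q : ℝ × ℝ => g q.1 q.2)) :
    Continuous (I (fun r z => (g r z) ^ 2)) := I_cont (g := fun r z => (g r z) ^ 2) (sqc hg)

theorem B.add {f g : ℝ → ℝ → ℝ} (hf : B f) (hg : B g) : B (fun r z => f r z + g r z) := by
  obtain ⟨a, K, h⟩ := hf
  obtain ⟨b, L, k⟩ := hg
  refine ⟨max a b, K + L, fun r hr z => (abs_add_le _ _).trans ?_⟩
  exact add_le_add (h r ((le_max_left _ _).trans hr) z) (k r ((le_max_right _ _).trans hr) z)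

theorem B.mul {f g : ℝ → ℝ → ℝ} (hf : B f) (hg : B g) : B (fun r z => f r z * g r z) := by
  obtain ⟨a, K, h⟩ := hf
  obtain ⟨b, L, k⟩ := hg
  refine ⟨max a b, K * L, fun r hr z => ?_⟩
  rw [abs_mul]
  have h1 := h r ((le_max_left _ _).trans hr) z
  exact mul_le_mul h1 (k r ((le_max_right _ _).trans hr) z) (abs_nonneg _)
    ((abs_nonneg _).trans h1)

theorem B.const (c : ℝ) : B (fun _ _ => c) := ⟨0, |c|, fun _ _ _ => le_rfl⟩

theorem B.inv : B (fun r _ => r⁻¹) := by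
  refine ⟨1, 1, fun r hr _ => ?_⟩
  rw [abs_of_nonneg (by positivity)]
  exact inv_le_one_of_one_le₀ hr

theorem B.congr {f g : ℝ → ℝ → ℝ} (hf : B f) (h : ∀ r, 0 < r → ∀ z, g r z = f r z) : B g := by
  obtain ⟨a, K, k⟩ := hf
  refine ⟨max a 1, K, fun r hr z => ?_⟩
  rw [h r (by linarith [(le_max_right a 1).trans hr])]
  exact k r ((le_max_left _ _).trans hr) z

theorem int_mono {g h : ℝ → ℝ} (hg : Continuous g) (hh : Continuous h) {a b : ℝ} (hab : a ≤ b)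
    (H : ∀ s, a ≤ s → s ≤ b → g s ≤ h s) : ∫ s in a..b, g s ≤ ∫ s in a..b, h s :=
  intervalIntegral.integral_mono_on hab (hg.intervalIntegrable _ _) (hh.intervalIntegrable _ _)
    (fun s hs => H s hs.1 hs.2)

theorem U.congr {f g : ℝ → ℝ → ℝ} (hf : U f) (h : ∀ r, 0 < r → ∀ z, g r z = f r z) : U g := by
  obtain ⟨G, hG, a, K, k, l⟩ := hf
  refine ⟨G, hG, max a 1, K, fun r hr z => ?_, fun r hr => l r ((le_max_left _ _).trans hr)⟩
  rw [h r (by linarith [(le_max_right a 1).trans hr])]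
  exact k r ((le_max_left _ _).trans hr) z

theorem U.add {f g : ℝ → ℝ → ℝ} (hf : U f) (hg : U g) : U (fun r z => f r z + g r z) := by
  obtain ⟨G, hG, a, K, k, l⟩ := hf
  obtain ⟨H, hH, b, L, m, n⟩ := hg
  refine ⟨fun r z => G r z + H r z, hG.add hH, max a b, 2 * K + 2 * L, fun r hr z =>
    (abs_add_le _ _).trans (add_le_add (k r ((le_max_left _ _).trans hr) z)
      (m r ((le_max_right _ _).trans hr) z)), fun r hr => ?_⟩
  have h1 := l r ((le_max_left _ _).trans hr)
  have h2 := n r ((le_max_right _ _).trans hr)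
  have c1 := Isq_cont hG
  have c2 := Isq_cont hH
  calc ∫ s in r..(r + 1), I (fun r z => (G r z + H r z) ^ 2) s
      ≤ ∫ s in r..(r + 1), (2 * I (fun r z => (G r z) ^ 2) s
          + 2 * I (fun r z => (H r z) ^ 2) s) := by
        refine int_mono (Isq_cont (hG.add hH)) (by fun_prop) (by linarith) fun s _ _ => ?_
        rw [← I_cmul, ← I_cmul, ← I_add (by fun_prop) (by fun_prop)]
        refine I_mono (by fun_prop) (by fun_prop) fun z => ?_
        nlinarith [sq_nonneg (G s z - H s z)]
    _ = 2 * (∫ s in r..(r + 1), I (fun r z => (G r z) ^ 2) s)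
          + 2 * ∫ s in r..(r + 1), I (fun r z => (H r z) ^ 2) s := by
        rw [intervalIntegral.integral_add ((by fun_prop : Continuous _).intervalIntegrable _ _)
          ((by fun_prop : Continuous _).intervalIntegrable _ _),
          intervalIntegral.integral_const_mul, intervalIntegral.integral_const_mul]
    _ ≤ _ := by linarith

theorem U.bmul {f g : ℝ → ℝ → ℝ} (hf : B f) (hg : U g) : U (fun r z => f r z * g r z) := by
  obtain ⟨a, K, k⟩ := hf
  obtain ⟨H, hH, b, L, m, n⟩ := hg
  refine ⟨fun r z => K * H r z, continuous_const.mul hH, max a b, K ^ 2 * L, fun r hr z => ?_,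
    fun r hr => ?_⟩
  · rw [abs_mul]
    have h1 := k r ((le_max_left _ _).trans hr) z
    exact mul_le_mul h1 (m r ((le_max_right _ _).trans hr) z) (abs_nonneg _)
      ((abs_nonneg _).trans h1)
  · have h2 := n r ((le_max_right _ _).trans hr)
    simp_rw [mul_pow, I_cmul]
    rw [intervalIntegral.integral_const_mul]
    exact mul_le_mul_of_nonneg_left h2 (sq_nonneg _)

theorem U.bd {f : ℝ → ℝ → ℝ} (hf : B f) : U f := by
  obtain ⟨a, K, k⟩ := hf
  refine ⟨fun _ _ => K, continuous_const, a, 2 * π * K ^ 2, k, fun r _ => ?_⟩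
  simp [I]
  apply le_of_eq
  ring

theorem U.of_le {f : ℝ → ℝ → ℝ} (hc : Continuous (fun q : ℝ × ℝ => f q.1 q.2)) {a C : ℝ}
    (h : ∀ r, a ≤ r → ∫ s in r..(r + 1), I (fun r z => (f r z) ^ 2) s ≤ C) : U f := by
  refine ⟨fun r z => |f r z|, hc.abs, a, C, fun _ _ _ => le_rfl, fun r hr => ?_⟩
  simp_rw [sq_abs]
  exact h r hr

theorem U.le {f : ℝ → ℝ → ℝ} (hc : Continuous (fun q : ℝ × ℝ => f q.1 q.2)) (hf : U f) :
    ∃ a C : ℝ, ∀ r, a ≤ r → ∫ s in r..(r + 1), I (fun r z => (f r z) ^ 2) s ≤ C := by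
  obtain ⟨G, hG, a, K, k, l⟩ := hf
  refine ⟨a, K, fun r hr => le_trans ?_ (l r hr)⟩
  refine int_mono (Isq_cont hc) (Isq_cont hG) (by linarith) fun s h1 _ => ?_
  refine I_mono (g := fun r z => (f r z) ^ 2) (h := fun r z => (G r z) ^ 2) (sqc hc) (sqc hG) fun z => ?_
  exact sq_le_sq' (by linarith [(abs_le.1 (k s (hr.trans h1) z)).1])
    (abs_le.1 (k s (hr.trans h1) z)).2


theorem cutoff {F F' F'' D G : ℝ → ℝ} (h1 : ∀ s, HasDerivAt F (F' s) s)
    (h2 : ∀ s, HasDerivAt F' (F'' s) s) (hF'' : Continuous F'') (hD : Continuous D)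
    (hG : Continuous G) (F0 : ∀ s, 0 ≤ F s) (D0 : ∀ s, 0 ≤ D s) (G0 : ∀ s, 0 ≤ G s)
    {a C1 C2 : ℝ} (H : ∀ s, a ≤ s → D s ≤ F'' s + G s)
    (hC1 : ∀ r, a ≤ r → ∫ s in r..(r + 1), F s ≤ C1)
    (hC2 : ∀ r, a ≤ r → ∫ s in r..(r + 1), G s ≤ C2) :
    ∀ r, a + 1 ≤ r → ∫ s in r..(r + 1), D s ≤ 14 * C1 + 5 * C2 := by
  intro r hr
  have hF : Continuous F := continuous_iff_continuousAt.2 fun s => (h1 s).continuousAt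
  have hF' : Continuous F' := continuous_iff_continuousAt.2 fun s => (h2 s).continuousAt
  set q : ℝ → ℝ := fun s => (s - r + 1) * (r + 2 - s) with hq
  set d : ℝ → ℝ := fun s => 1 - 2 * (s - r) with hd
  have qc : Continuous q := by fun_prop
  have dc : Continuous d := by fun_prop
  have hqd : ∀ s, HasDerivAt q (d s) s := by
    intro s
    have := (((hasDerivAt_id s).sub_const r).add_const 1).mul ((hasDerivAt_id s).const_sub (r + 2))
    refine this.congr_deriv ?_
    simp [hd]; ring
  have hdd : ∀ s, HasDerivAt d (-2) s := by
    intro s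
    have := (((hasDerivAt_id s).sub_const r).const_mul 2).const_sub 1
    refine this.congr_deriv ?_
    simp
  have hprim : ∀ s, HasDerivAt (fun s => F' s * (q s) ^ 2 - F s * (2 * q s * d s))
      (F'' s * (q s) ^ 2 - F s * (2 * (d s) ^ 2 - 4 * q s)) s := by
    intro s
    have := ((h2 s).mul ((hqd s).pow 2)).sub ((h1 s).mul (((hqd s).const_mul 2).mul (hdd s)))
    refine this.congr_deriv ?_
    simp; ring
  have hz : ∫ s in (r - 1)..(r + 2), (F'' s * (q s) ^ 2 - F s * (2 * (d s) ^ 2 - 4 * q s)) = 0 := by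
    rw [intervalIntegral.integral_eq_sub_of_hasDerivAt (fun s _ => hprim s)
      ((by fun_prop : Continuous _).intervalIntegrable _ _)]
    simp [hq]
  have tri : ∀ g : ℝ → ℝ, Continuous g → ∫ s in (r - 1)..(r + 2), g s =
      (∫ s in (r - 1)..r, g s) + (∫ s in r..(r + 1), g s) + ∫ s in (r + 1)..(r + 2), g s := by
    intro g hg
    rw [intervalIntegral.integral_add_adjacent_intervals (hg.intervalIntegrable _ _)
      (hg.intervalIntegrable _ _), intervalIntegral.integral_add_adjacent_intervals
      (hg.intervalIntegrable _ _) (hg.intervalIntegrable _ _)]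
  have e1 := hC1 (r - 1) (by linarith)
  have e2 := hC1 r (by linarith)
  have e3 := hC1 (r + 1) (by linarith)
  have f1 := hC2 (r - 1) (by linarith)
  have f2 := hC2 r (by linarith)
  have f3 := hC2 (r + 1) (by linarith)
  rw [show r - 1 + 1 = r by ring] at e1 f1
  rw [show r + 1 + 1 = r + 2 by ring] at e3 f3
  have A : ∫ s in r..(r + 1), 4 * D s ≤ ∫ s in r..(r + 1), D s * (q s) ^ 2 := by
    refine int_mono (by fun_prop) (by fun_prop) (by linarith) fun s h h' => ?_
    have : 2 ≤ q s := by simp only [hq]; nlinarith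
    nlinarith [D0 s, mul_nonneg (D0 s) (by nlinarith : 0 ≤ (q s) ^ 2 - 4)]
  have A1 : 0 ≤ ∫ s in (r - 1)..r, D s * (q s) ^ 2 :=
    intervalIntegral.integral_nonneg (by linarith) fun s _ => mul_nonneg (D0 s) (sq_nonneg _)
  have A2 : 0 ≤ ∫ s in (r + 1)..(r + 2), D s * (q s) ^ 2 :=
    intervalIntegral.integral_nonneg (by linarith) fun s _ => mul_nonneg (D0 s) (sq_nonneg _)
  have T1 := tri (fun s => D s * (q s) ^ 2) (by fun_prop)
  have Bd : ∫ s in (r - 1)..(r + 2), D s * (q s) ^ 2 ≤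
      ∫ s in (r - 1)..(r + 2), ((F'' s * (q s) ^ 2 - F s * (2 * (d s) ^ 2 - 4 * q s))
        + (18 * F s + 6 * G s)) := by
    refine int_mono (by fun_prop) (by fun_prop) (by linarith) fun s h h' => ?_
    have q0 : 0 ≤ q s := mul_nonneg (by linarith) (by linarith)
    have q1 : q s ≤ 9 / 4 := by simp only [hq]; nlinarith [sq_nonneg (s - r - 1 / 2)]
    have q2 : (q s) ^ 2 ≤ 6 := by nlinarith
    have d2 : (d s) ^ 2 ≤ 9 := by simp only [hd]; nlinarith
    have := mul_le_mul_of_nonneg_right (H s (by linarith)) (sq_nonneg (q s))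
    nlinarith [mul_nonneg (G0 s) (by linarith : 0 ≤ 6 - (q s) ^ 2),
      mul_nonneg (F0 s) (by linarith : 0 ≤ 18 - (2 * (d s) ^ 2 - 4 * q s))]
  rw [intervalIntegral.integral_add ((by fun_prop : Continuous _).intervalIntegrable _ _)
    ((by fun_prop : Continuous _).intervalIntegrable _ _), hz,
    intervalIntegral.integral_add ((by fun_prop : Continuous _).intervalIntegrable _ _)
    ((by fun_prop : Continuous _).intervalIntegrable _ _), intervalIntegral.integral_const_mul,
    intervalIntegral.integral_const_mul, tri F hF, tri G hG] at Bd
  rw [intervalIntegral.integral_const_mul] at A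
  have z1 : 0 ≤ ∫ s in r..(r + 1), F s :=
    intervalIntegral.integral_nonneg (by linarith) fun s _ => F0 s
  have z2 : 0 ≤ ∫ s in r..(r + 1), G s :=
    intervalIntegral.integral_nonneg (by linarith) fun s _ => G0 s
  linarith

theorem I_sq_deriv {f : ℝ → ℝ → ℝ} (hf : Sm f) (r : ℝ) :
    HasDerivAt (I (fun r z => (f r z) ^ 2)) (I (fun r z => 2 * (f r z * pdr f r z)) r) r := by
  have h := I_deriv hf.sq r
  have e : pdr (fun r z => (f r z) ^ 2) = fun r z => 2 * (f r z * pdr f r z) := by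
    funext r z
    have := ((hf.hr r z).pow 2).deriv
    unfold pdr at this ⊢
    simp only [Pi.pow_def] at this
    rw [this]; simp; ring
  rwa [e] at h

theorem I_sq_deriv2 {f : ℝ → ℝ → ℝ} (hf : Sm f) (r : ℝ) :
    HasDerivAt (I (fun r z => 2 * (f r z * pdr f r z)))
      (I (fun r z => 2 * (pdr f r z) ^ 2 + 2 * (f r z * pdr (pdr f) r z)) r) r := by
  have h := I_deriv ((hf.mul hf.pdr).cmul 2) r
  have e : pdr (fun r z => 2 * (f r z * pdr f r z)) =
      fun r z => 2 * (pdr f r z) ^ 2 + 2 * (f r z * pdr (pdr f) r z) := by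
    funext r z
    have := (((hf.hr r z).mul (hf.pdr.hr r z)).const_mul 2)
    refine HasDerivAt.deriv ?_
    refine this.congr_deriv ?_
    ring
  rwa [e] at h

theorem core {f T W : ℝ → ℝ → ℝ} (hf : Sm f) (hT : Sm T) (hTP : Per T)
    (hW : Continuous (fun q : ℝ × ℝ => W q.1 q.2)) (hU : U f) (hWU : U W) {a : ℝ}
    (H : ∀ r, a ≤ r → ∀ z, (pdr f r z) ^ 2 + (pdz f r z) ^ 2 ≤
      2 * (pdr f r z) ^ 2 + 2 * (f r z * pdr (pdr f) r z) + pdz T r z + (W r z) ^ 2) :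
    U (pdr f) ∧ U (pdz f) := by
  obtain ⟨a1, C1, h1⟩ := hU.le hf.cont
  obtain ⟨a2, C2, h2⟩ := hWU.le hW
  have c0 := hf.cont
  have c1 := hf.pdr.cont
  have c2 := hf.pdz.cont
  have c3 := hf.pdr.pdr.cont
  have c4 := hT.pdz.cont
  have key := cutoff (F := I (fun r z => (f r z) ^ 2)) (fun s => I_sq_deriv hf s)
    (fun s => I_sq_deriv2 hf s) (I_cont (by fun_prop))
    (D := I (fun r z => (pdr f r z) ^ 2 + (pdz f r z) ^ 2)) (G := I (fun r z => (W r z) ^ 2))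
    (I_cont (by fun_prop)) (I_cont (by fun_prop)) (fun s => I_nonneg fun z => sq_nonneg _)
    (fun s => I_nonneg fun z => add_nonneg (sq_nonneg _) (sq_nonneg _))
    (fun s => I_nonneg fun z => sq_nonneg _) (a := max a (max a1 a2)) (C1 := C1) (C2 := C2)
    (fun s hs => ?_) (fun r hr => h1 r (by simp at hr; tauto)) (fun r hr => h2 r (by simp at hr; tauto))
  · constructor
    · refine U.of_le c1 (a := max a (max a1 a2) + 1) fun r hr => le_trans ?_ (key r hr)
      refine int_mono (Isq_cont c1) (I_cont (by fun_prop)) (by linarith) fun s _ _ => ?_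
      exact I_mono (by fun_prop) (by fun_prop) fun z => by nlinarith [sq_nonneg (pdz f s z)]
    · refine U.of_le c2 (a := max a (max a1 a2) + 1) fun r hr => le_trans ?_ (key r hr)
      refine int_mono (Isq_cont c2) (I_cont (by fun_prop)) (by linarith) fun s _ _ => ?_
      exact I_mono (by fun_prop) (by fun_prop) fun z => by nlinarith [sq_nonneg (pdr f s z)]
  · have e := I_pdz hT hTP s
    have := I_mono (r := s) (g := fun r z => (pdr f r z) ^ 2 + (pdz f r z) ^ 2)
      (h := fun r z => 2 * (pdr f r z) ^ 2 + 2 * (f r z * pdr (pdr f) r z) + pdz T r z + (W r z) ^ 2)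
      (by fun_prop) (by fun_prop) (fun z => H s (by simp at hs; tauto) z)
    rw [I_add (g := fun r z => 2 * (pdr f r z) ^ 2 + 2 * (f r z * pdr (pdr f) r z) + pdz T r z)
      (by fun_prop) (by fun_prop),
      I_add (g := fun r z => 2 * (pdr f r z) ^ 2 + 2 * (f r z * pdr (pdr f) r z))
      (by fun_prop) (by fun_prop), e] at this
    linarith

theorem Per.mul {f g : ℝ → ℝ → ℝ} (hf : Per f) (hg : Per g) : Per (fun r z => f r z * g r z) :=
  fun r z => by simp only [hf r z, hg r z]

/-- Caccioppoli. -/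
theorem lemA {f b1 b2 g : ℝ → ℝ → ℝ} (hf : Sm f) (hP : Per f) (hU : U f) (hb1 : B b1) (hb2 : B b2)
    (hg : U g) (H : ∀ r, 0 < r → ∀ z, pdr (pdr f) r z + pdz (pdz f) r z =
      b1 r z * pdr f r z + b2 r z * pdz f r z + g r z) : U (pdr f) ∧ U (pdz f) := by
  obtain ⟨a1, K1, h1⟩ := hb1
  obtain ⟨a2, K2, h2⟩ := hb2
  obtain ⟨G, hG, a3, K3, h3, h4⟩ := hg
  set K := K1 ^ 2 + K2 ^ 2 + 1 with hK
  have hGU : U G := ⟨fun r z => |G r z|, hG.abs, a3, K3, fun _ _ _ => le_rfl, fun r hr => by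
    simp_rw [sq_abs]; exact h4 r hr⟩
  have hUf : U (fun r z => |f r z|) := by
    obtain ⟨G, hG, a3, K3, h3, h4⟩ := hU
    exact ⟨G, hG, a3, K3, fun r hr z => by rw [abs_abs]; exact h3 r hr z, h4⟩
  have c0 := hf.cont
  refine core (T := fun r z => 2 * (f r z * pdz f r z)) (W := fun r z => K * |f r z| + G r z)
    (a := max (max a1 a2) (max a3 1)) hf
    ((hf.mul hf.pdz).cmul 2) (fun r z => by simp [hP r z, hP.pdz r z]) (by fun_prop) hU
    ((U.bmul (B.const K) hUf).add hGU) fun r hr z => ?_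
  simp only [max_le_iff] at hr
  have e : pdz (fun r z => 2 * (f r z * pdz f r z)) r z =
      2 * (pdz f r z) ^ 2 + 2 * (f r z * pdz (pdz f) r z) := by
    refine HasDerivAt.deriv ?_
    refine (((hf.hz r z).mul (hf.pdz.hz r z)).const_mul 2).congr_deriv ?_
    ring
  rw [e]
  have E := H r (by linarith) z
  have m1 := h1 r hr.1.1 z
  have m2 := h2 r hr.1.2 z
  have m3 := h3 r hr.2.1 z
  have G0 := (abs_nonneg _).trans m3
  rw [show pdr (pdr f) r z = b1 r z * pdr f r z + b2 r z * pdz f r z + g r z - pdz (pdz f) r z by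
    linarith]
  have k1 : (b1 r z) ^ 2 ≤ K1 ^ 2 := sq_le_sq' (by linarith [(abs_le.1 m1).1]) (abs_le.1 m1).2
  have k2 : (b2 r z) ^ 2 ≤ K2 ^ 2 := sq_le_sq' (by linarith [(abs_le.1 m2).1]) (abs_le.1 m2).2
  have p1 := mul_le_mul_of_nonneg_right k1 (sq_nonneg (f r z))
  have p2 := mul_le_mul_of_nonneg_right k2 (sq_nonneg (f r z))
  have p3 : -(f r z * g r z) ≤ |f r z| * G r z := by
    have : |f r z * g r z| ≤ |f r z| * G r z := by
      rw [abs_mul]; exact mul_le_mul_of_nonneg_left m3 (abs_nonneg _)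
    linarith [neg_abs_le (f r z * g r z)]
  have p4 : (K * |f r z| + G r z) ^ 2 = K ^ 2 * (f r z) ^ 2 + 2 * K * (|f r z| * G r z)
      + (G r z) ^ 2 := by rw [← sq_abs (f r z)]; ring
  have K0 : 1 ≤ K := by rw [hK]; nlinarith [sq_nonneg K1, sq_nonneg K2]
  have p5 : K * (f r z) ^ 2 ≤ K ^ 2 * (f r z) ^ 2 :=
    mul_le_mul_of_nonneg_right (by nlinarith) (sq_nonneg _)
  have p6 : |f r z| * G r z ≤ K * (|f r z| * G r z) := by
    nlinarith [mul_nonneg (abs_nonneg (f r z)) G0]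
  rw [p4]
  have p7 : K * (f r z) ^ 2 = K1 ^ 2 * (f r z) ^ 2 + K2 ^ 2 * (f r z) ^ 2 + (f r z) ^ 2 := by
    rw [hK]; ring
  nlinarith [sq_nonneg (pdr f r z + f r z * b1 r z), sq_nonneg (pdz f r z + f r z * b2 r z),
    sq_nonneg (f r z), sq_nonneg (G r z)]

/-- `H²` regularity. -/
theorem lemB {f h : ℝ → ℝ → ℝ} (hf : Sm f) (hP : Per f) (hU : U (pdz f))
    (hh : U h) (H : ∀ r, 0 < r → ∀ z, pdr (pdr f) r z + pdz (pdz f) r z = h r z) :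
    U (pdr (pdz f)) ∧ U (pdz (pdz f)) ∧ U (pdr (pdr f)) := by
  have hh' : U (fun r z => pdr (pdr f) r z + pdz (pdz f) r z) := hh.congr H
  have c1 := hf.pdr.pdr.cont
  have c2 := hf.pdz.pdz.cont
  have := core (f := pdz f) (T := fun r z => (-2) * (pdz f r z * pdr (pdr f) r z))
    (W := fun r z => pdr (pdr f) r z + pdz (pdz f) r z)
    (a := 0) hf.pdz ((hf.pdz.mul hf.pdr.pdr).cmul (-2))
    (fun r z => by simp [hP.pdz r z, hP.pdr.pdr r z]) (by fun_prop) hU hh' fun r hr z => ?_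
  · refine ⟨this.1, this.2, ?_⟩
    exact (hh'.add (U.bmul (B.const (-1)) this.2)).congr fun r _ z => by ring
  have e : pdz (fun r z => (-2) * (pdz f r z * pdr (pdr f) r z)) r z =
      (-2) * (pdz (pdz f) r z * pdr (pdr f) r z + pdz f r z * pdz (pdr (pdr f)) r z) := by
    refine HasDerivAt.deriv ?_
    exact (((hf.pdz.hz r z).mul (hf.pdr.pdr.hz r z)).const_mul (-2))
  have e2 : pdr (pdr (pdz f)) r z = pdz (pdr (pdr f)) r z := by
    rw [show pdr (pdz f) = pdz (pdr f) from funext fun r => funext fun z => hf.comm r z]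
    exact hf.pdr.comm r z
  rw [e, e2]
  nlinarith [sq_nonneg (pdr (pdr f) r z), sq_nonneg (pdr (pdz f) r z)]

theorem sob1 {F F' : ℝ → ℝ} (h1 : ∀ s, HasDerivAt F (F' s) s) (hF' : Continuous F')
    {M : ℝ → ℝ} (hM : Continuous M) (HM : ∀ s, |F' s| ≤ M s) (r : ℝ) :
    F r ≤ (∫ s in r..(r + 1), F s) + ∫ s in r..(r + 1), M s := by
  have hF : Continuous F := continuous_iff_continuousAt.2 fun s => (h1 s).continuousAt
  have k : ∀ s, r ≤ s → s ≤ r + 1 → F r - (∫ s in r..(r + 1), M s) ≤ F s := by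
    intro s hs hs'
    have e := intervalIntegral.integral_eq_sub_of_hasDerivAt (fun x _ => h1 x)
      (hF'.intervalIntegrable r s)
    have l1 : -(∫ x in r..s, F' x) ≤ ∫ x in r..s, M x := by
      rw [← intervalIntegral.integral_neg]
      exact int_mono hF'.neg hM hs fun x _ _ => by
        simp only [Pi.neg_apply]; linarith [neg_abs_le (F' x), HM x]
    have l2 := intervalIntegral.integral_add_adjacent_intervals
      (hM.intervalIntegrable (μ := volume) r s) (hM.intervalIntegrable s (r + 1))
    have l3 : 0 ≤ ∫ x in s..(r + 1), M x :=
      intervalIntegral.integral_nonneg hs' fun x _ => (abs_nonneg _).trans (HM x)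
    linarith
  have := int_mono (continuous_const (y := F r - (∫ s in r..(r + 1), M s))) hF
    (by linarith : r ≤ r + 1) k
  simp at this
  linarith

theorem sob_r {f : ℝ → ℝ → ℝ} (hf : Sm f) (h0 : U f) (h1 : U (pdr f)) :
    ∃ a C : ℝ, ∀ r, a ≤ r → I (fun r z => (f r z) ^ 2) r ≤ C := by
  have c0 := hf.cont
  have c1 := hf.pdr.cont
  obtain ⟨a0, C0, k0⟩ := h0.le c0
  obtain ⟨a1, C1, k1⟩ := h1.le c1
  refine ⟨max a0 a1, C0 + (C0 + C1), fun r hr => ?_⟩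
  simp only [max_le_iff] at hr
  have i0 := Isq_cont c0
  have i1 := Isq_cont c1
  have := sob1 (F := I (fun r z => (f r z) ^ 2)) (fun s => I_sq_deriv hf s) (I_cont (by fun_prop))
    (M := fun s => I (fun r z => (f r z) ^ 2) s + I (fun r z => (pdr f r z) ^ 2) s)
    (by fun_prop) (fun s => ?_) r
  · rw [intervalIntegral.integral_add (i0.intervalIntegrable _ _) (i1.intervalIntegrable _ _)]
      at this
    linarith [k0 r hr.1, k1 r hr.2]
  · rw [← I_add (by fun_prop) (by fun_prop), abs_le]
    constructor
    · rw [neg_le, neg_eq_neg_one_mul, ← I_cmul]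
      exact I_mono (by fun_prop) (by fun_prop) fun z => by nlinarith [sq_nonneg (f s z + pdr f s z)]
    · exact I_mono (by fun_prop) (by fun_prop) fun z => by nlinarith [sq_nonneg (f s z - pdr f s z)]

theorem I_shift {g : ℝ → ℝ → ℝ} (hg : Continuous (fun q : ℝ × ℝ => g q.1 q.2)) (hP : Per g)
    (g0 : ∀ r z, 0 ≤ g r z) (r z : ℝ) : ∫ t in z..(z + 1), g r t ≤ I g r := by
  have e : I g r = ∫ t in z..(z + 2 * π), g r t := by
    have := Function.Periodic.intervalIntegral_add_eq (f := g r) (T := 2 * π) (hP r) (-π) z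
    rw [show -π + 2 * π = π by ring] at this
    exact this
  rw [e, ← intervalIntegral.integral_add_adjacent_intervals (ii hg r z (z + 1))
    (ii hg r (z + 1) (z + 2 * π))]
  have : 0 ≤ ∫ t in (z + 1)..(z + 2 * π), g r t :=
    intervalIntegral.integral_nonneg (by linarith [pi_gt_three]) fun t _ => g0 r t
  linarith

theorem sob {f : ℝ → ℝ → ℝ} (hf : Sm f) (hP : Per f) (h0 : U f) (h1 : U (pdr f)) (h2 : U (pdz f))
    (h3 : U (pdr (pdz f))) : B f := by
  obtain ⟨a0, C0, k0⟩ := sob_r hf h0 h1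
  obtain ⟨a1, C1, k1⟩ := sob_r hf.pdz h2 h3
  refine ⟨max a0 a1, C0 + (C0 + C1) + 1, fun r hr z => ?_⟩
  simp only [max_le_iff] at hr
  have c0 := hf.cont
  have c1 := hf.pdz.cont
  have s0 := cont_slice c0 r
  have s1 := cont_slice c1 r
  have := sob1 (F := fun t => (f r t) ^ 2) (F' := fun t => 2 * (f r t * pdz f r t))
    (M := fun t => (f r t) ^ 2 + (pdz f r t) ^ 2) (fun t => ?_) (by fun_prop) (by fun_prop)
    (fun t => ?_) z
  · rw [intervalIntegral.integral_add ((by fun_prop : Continuous _).intervalIntegrable _ _)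
      ((by fun_prop : Continuous _).intervalIntegrable _ _)] at this
    have m0 := I_shift (g := fun r z => (f r z) ^ 2) (by fun_prop) (fun r z => by simp [hP r z])
      (fun _ _ => sq_nonneg _) r z
    have m1 := I_shift (g := fun r z => (pdz f r z) ^ 2) (by fun_prop)
      (fun r z => by simp [hP.pdz r z]) (fun _ _ => sq_nonneg _) r z
    have := k0 r hr.1
    have := k1 r hr.2
    have : |f r z| ≤ (f r z) ^ 2 + 1 := by
      rw [← sq_abs]; nlinarith [sq_nonneg (|f r z| - 1), abs_nonneg (f r z)]
    linarith
  · refine ((hf.hz r t).pow 2).congr_deriv ?_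
    simp; ring
  · rw [abs_le]
    constructor <;> nlinarith [sq_nonneg (f r t - pdz f r t), sq_nonneg (f r t + pdz f r t)]

/-- Eventually bounded, continuous and periodic implies bounded on `r ≥ 0`. -/
theorem B.glob {f : ℝ → ℝ → ℝ} (hc : Continuous (fun q : ℝ × ℝ => f q.1 q.2)) (hP : Per f)
    (hB : B f) : ∃ C, 0 ≤ C ∧ ∀ r, 0 ≤ r → ∀ z, |f r z| ≤ C := by
  obtain ⟨a, K, h⟩ := hB
  have hK : IsCompact (Set.Icc 0 a ×ˢ Set.Icc 0 (0 + 2 * π)) := isCompact_Icc.prod isCompact_Icc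
  obtain ⟨C, hC⟩ := hK.exists_bound_of_continuousOn hc.continuousOn
  refine ⟨max (max C K) 0, le_max_right _ _, fun r hr z => ?_⟩
  by_cases hra : a ≤ r
  · exact (h r hra z).trans ((le_max_right _ _).trans (le_max_left _ _))
  · obtain ⟨y, hy, e⟩ := Function.Periodic.exists_mem_Ico (f := f r) (hP r) (by positivity) z 0
    rw [e]
    exact (hC (r, y) ⟨⟨hr, (not_le.1 hra).le⟩, hy.1, hy.2.le⟩).trans
      ((le_max_left _ _).trans (le_max_left _ _))


theorem dirU {f E : ℝ → ℝ → ℝ} (hf : Continuous (fun q : ℝ × ℝ => f q.1 q.2))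
    (h : ∀ r, 1 ≤ r → ∀ z, (f r z) ^ 2 ≤ E r z)
    (hdir : ∫⁻ q in Set.Ioi (0:ℝ) ×ˢ Set.Icc (-π) π,
      ENNReal.ofReal (E q.1 q.2 * q.1) < ⊤) : U f := by
  refine U.of_le hf (a := 1) (C := (∫⁻ q in Set.Ioi (0:ℝ) ×ˢ Set.Icc (-π) π,
      ENNReal.ofReal (E q.1 q.2 * q.1)).toReal) fun r hr => ?_
  have c2 : Continuous (fun q : ℝ × ℝ => (f q.1 q.2) ^ 2) := by fun_prop
  have hintg : IntegrableOn (fun q : ℝ × ℝ => (f q.1 q.2) ^ 2)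
      (Set.Ioc r (r + 1) ×ˢ Set.Ioc (-π) π) (volume.prod volume) := by
    refine IntegrableOn.mono_set (t := Set.Icc r (r + 1) ×ˢ Set.Icc (-π) π) ?_
      (Set.prod_mono Set.Ioc_subset_Icc_self Set.Ioc_subset_Icc_self)
    exact c2.continuousOn.integrableOn_compact (isCompact_Icc.prod isCompact_Icc)
  have e : ∫ s in r..(r + 1), I (fun r z => (f r z) ^ 2) s =
      ∫ q in Set.Ioc r (r + 1) ×ˢ Set.Ioc (-π) π, (f q.1 q.2) ^ 2 := by
    unfold I
    rw [intervalIntegral.integral_of_le (by linarith)]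
    simp_rw [intervalIntegral.integral_of_le (by linarith [pi_pos] : -π ≤ π)]
    exact (setIntegral_prod (μ := volume) (ν := volume) _ hintg).symm
  rw [e, integral_eq_lintegral_of_nonneg_ae (Filter.Eventually.of_forall fun q => sq_nonneg _)
    c2.aestronglyMeasurable]
  refine ENNReal.toReal_mono hdir.ne ?_
  refine le_trans (setLIntegral_mono_ae' (g := fun q : ℝ × ℝ => ENNReal.ofReal (E q.1 q.2 * q.1))
    (measurableSet_Ioc.prod measurableSet_Ioc) (Filter.Eventually.of_forall fun q hq => ?_))
    (lintegral_mono_set ?_)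
  · have h1 : 1 ≤ q.1 := hr.trans hq.1.1.le
    have := h q.1 h1 q.2
    exact ENNReal.ofReal_le_ofReal (by nlinarith [sq_nonneg (f q.1 q.2)])
  · exact Set.prod_mono (fun s hs => by
      have := hs.1
      exact Set.mem_Ioi.2 (by linarith)) Set.Ioc_subset_Icc_self

theorem Sm.commf {f : ℝ → ℝ → ℝ} (hf : Sm f) :
    _root_.pdr (_root_.pdz f) = _root_.pdz (_root_.pdr f) :=
  funext fun r => funext fun z => hf.comm r z

theorem pdr_sub {f g : ℝ → ℝ → ℝ} (hf : Sm f) (hg : Sm g) :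
    pdr (fun r z => f r z - g r z) = fun r z => pdr f r z - pdr g r z :=
  funext fun r => funext fun z => ((hf.hr r z).sub (hg.hr r z)).deriv

theorem pdz_sub {f g : ℝ → ℝ → ℝ} (hf : Sm f) (hg : Sm g) :
    pdz (fun r z => f r z - g r z) = fun r z => pdz f r z - pdz g r z :=
  funext fun r => funext fun z => ((hf.hz r z).sub (hg.hz r z)).deriv

theorem zderiv0 {E : ℝ → ℝ} {e z : ℝ} (h : HasDerivAt E e z) (h0 : ∀ t, E t = 0) : e = 0 := by
  have : E = fun _ => 0 := funext h0
  rw [this] at h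
  exact h.unique (hasDerivAt_const z 0)

theorem rderiv0 {E : ℝ → ℝ} {e r : ℝ} (h : HasDerivAt E e r) (hr : 0 < r)
    (h0 : ∀ s, 0 < s → E s = 0) : e = 0 := by
  have : E =ᶠ[nhds r] fun _ => 0 := by
    filter_upwards [Ioi_mem_nhds hr] with s hs using h0 s hs
  exact (h.congr_of_eventuallyEq this.symm).unique (hasDerivAt_const r 0)

theorem lapz {f : ℝ → ℝ → ℝ} (hf : Sm f) {r z e : ℝ} {E : ℝ → ℝ} (hE : HasDerivAt E e z)
    (H : ∀ t, pdr (pdr f) r t + pdz (pdz f) r t = E t) :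
    pdr (pdr (pdz f)) r z + pdz (pdz (pdz f)) r z = e := by
  rw [hf.commf, hf.pdr.commf]
  have h1 := (hf.pdr.pdr.hz r z).add (hf.pdz.pdz.hz r z)
  have := zderiv0 (h1.sub hE) (fun t => by
    have := H t
    simp only [Pi.sub_apply, Pi.add_apply]
    linarith)
  linarith

section eqs
variable {ur uθ uz p : ℝ → ℝ → ℝ}

/-- The angular vorticity. -/
noncomputable def vort (ur uz : ℝ → ℝ → ℝ) : ℝ → ℝ → ℝ := fun r z => pdz ur r z - pdr uz r z

theorem vort_sm (hur : Sm ur) (huz : Sm uz) : Sm (vort ur uz) := hur.pdz.sub huz.pdr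

theorem div_z (hur : Sm ur) (huz : Sm uz) (heq : ASNS ur uθ uz p Set.univ) {r : ℝ} (hr : 0 < r)
    (z : ℝ) : pdz (pdr ur) r z + r⁻¹ * pdz ur r z + pdz (pdz uz) r z = 0 := by
  refine zderiv0 (((hur.pdr.hz r z).add ((hur.hz r z).const_mul r⁻¹)).add (huz.pdz.hz r z))
    fun t => ?_
  simp only [Pi.add_apply]
  linear_combination (heq r hr t trivial).2.2.2

theorem div_r (hur : Sm ur) (huz : Sm uz) (heq : ASNS ur uθ uz p Set.univ) {r : ℝ} (hr : 0 < r)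
    (z : ℝ) : pdr (pdr ur) r z + r⁻¹ * pdr ur r z - r⁻¹ ^ 2 * ur r z + pdz (pdr uz) r z = 0 := by
  have := rderiv0 (((hur.pdr.hr r z).add ((hasDerivAt_inv hr.ne').mul (hur.hr r z))).add
    (huz.pdz.hr r z)) hr fun s hs => ?_
  · rw [huz.commf] at this
    linear_combination this
  simp only [Pi.add_apply, Pi.mul_apply]
  linear_combination (heq s hs z trivial).2.2.2

theorem lap_ur (hur : Sm ur) (huz : Sm uz) (heq : ASNS ur uθ uz p Set.univ) {r : ℝ} (hr : 0 < r)
    (z : ℝ) : pdr (pdr ur) r z + pdz (pdz ur) r z =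
      pdz (vort ur uz) r z - r⁻¹ * pdr ur r z + r⁻¹ ^ 2 * ur r z := by
  unfold vort
  rw [pdz_sub hur.pdz huz.pdr]
  linear_combination div_r hur huz heq hr z

theorem lap_uz (hur : Sm ur) (huz : Sm uz) (heq : ASNS ur uθ uz p Set.univ) {r : ℝ} (hr : 0 < r)
    (z : ℝ) : pdr (pdr uz) r z + pdz (pdz uz) r z =
      (-1) * pdr (vort ur uz) r z - r⁻¹ * pdz ur r z := by
  unfold vort
  rw [pdr_sub hur.pdz huz.pdr, hur.commf]
  linear_combination div_z hur huz heq hr z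

theorem lap_uθ (heq : ASNS ur uθ uz p Set.univ) {r : ℝ} (hr : 0 < r)
    (z : ℝ) : pdr (pdr uθ) r z + pdz (pdz uθ) r z =
      ur r z * pdr uθ r z + uz r z * pdz uθ r z + r⁻¹ * (ur r z * uθ r z)
        - r⁻¹ * pdr uθ r z + r⁻¹ ^ 2 * uθ r z := by
  linear_combination -(heq r hr z trivial).2.1

theorem lap_w (hur : Sm ur) (huθ : Sm uθ) (huz : Sm uz) (hp : Sm p)
    (heq : ASNS ur uθ uz p Set.univ) {r : ℝ} (hr : 0 < r) (z : ℝ) :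
    pdr (pdr (vort ur uz)) r z + pdz (pdz (vort ur uz)) r z =
      ur r z * pdr (vort ur uz) r z + uz r z * pdz (vort ur uz) r z
      - r⁻¹ * pdr (vort ur uz) r z + r⁻¹ ^ 2 * vort ur uz r z
      - r⁻¹ * (ur r z * vort ur uz r z) - 2 * (r⁻¹ * (uθ r z * pdz uθ r z)) := by
  have e1 := zderiv0 (((((((((hur.hz r z).mul (hur.pdr.hz r z)).add
    ((huz.hz r z).mul (hur.pdz.hz r z))).sub (((huθ.hz r z).mul (huθ.hz r z)).const_mul r⁻¹)).add
    (hp.pdr.hz r z)).sub (hur.pdr.pdr.hz r z)).sub ((hur.pdr.hz r z).const_mul r⁻¹)).sub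
    (hur.pdz.pdz.hz r z)).add ((hur.hz r z).const_mul (r⁻¹ ^ 2))) (fun t => by
      simp only [Pi.add_apply, Pi.mul_apply, Pi.sub_apply]
      linear_combination (heq r hr t trivial).1)
  have e3 := rderiv0 (((((((hur.hr r z).mul (huz.pdr.hr r z)).add
    ((huz.hr r z).mul (huz.pdz.hr r z))).add
    (hp.pdz.hr r z)).sub (huz.pdr.pdr.hr r z)).sub
    ((hasDerivAt_inv hr.ne').mul (huz.pdr.hr r z))).sub
    (huz.pdz.pdz.hr r z)) hr (fun s hs => by
      simp only [Pi.add_apply, Pi.mul_apply, Pi.sub_apply]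
      linear_combination (heq s hs z trivial).2.2.1)
  have e4 := (heq r hr z trivial).2.2.2
  unfold vort
  rw [pdr_sub hur.pdz huz.pdr, pdz_sub hur.pdz huz.pdr, pdr_sub hur.pdz.pdr huz.pdr.pdr,
    pdz_sub hur.pdz.pdz huz.pdr.pdz]
  rw [huz.pdz.commf] at e3
  simp only [hur.commf, huz.commf, hp.commf, hur.pdr.commf] at e1 e3 ⊢
  linear_combination e3 - e1 + (pdz ur r z - pdr uz r z) * e4

end eqs


section main
variable {ur uθ uz p : ℝ → ℝ → ℝ}

theorem U.smul {f : ℝ → ℝ → ℝ} (c : ℝ) (hf : U f) : U (fun r z => c * f r z) :=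
  U.bmul (B.const c) hf

theorem pdz_bdd (hur : Sm ur) (huθ : Sm uθ) (huz : Sm uz) (hp : Sm p)
    (pr : Per ur) (pθ : Per uθ) (pz : Per uz) (heq : ASNS ur uθ uz p Set.univ)
    (br : B ur) (bθ : B uθ) (bz : B uz)
    (rr : U (pdr ur)) (rz : U (pdz ur)) (θr : U (pdr uθ)) (θz : U (pdz uθ))
    (zr : U (pdr uz)) (zz : U (pdz uz)) : B (pdz p) := by
  have hw := vort_sm hur huz
  have pw : Per (vort ur uz) := fun r z => by unfold vort; rw [pr.pdz r z, pz.pdr r z]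
  have uw : U (vort ur uz) := (rz.add (zr.smul (-1))).congr fun r _ z => by unfold vort; ring
  have i1 := B.inv
  have i2 : B (fun r _ => r⁻¹ * r⁻¹) := B.inv.mul B.inv
  -- first derivatives of the vorticity
  have g1 := ((U.bmul i2 uw).add (U.bmul (((B.const (-1)).mul i1).mul br) uw)).add
    (U.bmul (((B.const (-2)).mul i1).mul bθ) θz)
  obtain ⟨wr, wz⟩ := lemA hw pw uw (br.add ((B.const (-1)).mul i1)) bz g1 (fun r hr z => by
    linear_combination lap_w hur huθ huz hp heq hr z)
  -- second derivatives of everything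
  obtain ⟨wrz, wzz, wrr⟩ := lemB hw pw wz
    (((U.bmul (br.add ((B.const (-1)).mul i1)) wr).add (U.bmul bz wz)).add g1) (fun r hr z => by
    linear_combination lap_w hur huθ huz hp heq hr z)
  have bw : B (vort ur uz) := sob hw pw uw wr wz wrz
  obtain ⟨θrz, θzz, θrr⟩ := lemB huθ pθ θz
    (((U.bmul (br.add ((B.const (-1)).mul i1)) θr).add (U.bmul bz θz)).add
      (U.bd (((i1.mul br).mul bθ).add (i2.mul bθ)))) (fun r hr z => by
    linear_combination lap_uθ heq hr z)
  obtain ⟨rrz, rzz, rrr⟩ := lemB hur pr rz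
    ((wz.add (U.bmul ((B.const (-1)).mul i1) rr)).add
      (U.bd (i2.mul br))) (fun r hr z => by
    linear_combination lap_ur hur huz heq hr z)
  obtain ⟨zrz, zzz, zrr⟩ := lemB huz pz zz
    ((wr.smul (-1)).add (U.bmul ((B.const (-1)).mul i1) rz)) (fun r hr z => by
    linear_combination lap_uz hur huz heq hr z)
  -- third derivatives, one of them in `z`
  obtain ⟨rrzz, -, -⟩ := lemB hur.pdz pr.pdz rzz
    ((wzz.add (U.bmul ((B.const (-1)).mul i1) rrz)).add
      (U.bmul i2 rz)) (fun r hr z => by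
    have := lapz hur (((hw.pdz.hz r z).sub ((hur.pdr.hz r z).const_mul r⁻¹)).add
      ((hur.hz r z).const_mul (r⁻¹ ^ 2))) (fun t => lap_ur hur huz heq hr t)
    rw [hur.commf] at this ⊢
    linear_combination this)
  have brz : B (pdz ur) := sob hur.pdz pr.pdz rz rrz rzz rrzz
  obtain ⟨zrzz, -, -⟩ := lemB huz.pdz pz.pdz zzz
    ((wrz.smul (-1)).add (U.bmul ((B.const (-1)).mul i1) rzz)) (fun r hr z => by
    have := lapz huz (((hw.pdr.hz r z).const_mul (-1)).sub ((hur.pdz.hz r z).const_mul r⁻¹))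
      (fun t => lap_uz hur huz heq hr t)
    rw [hw.commf]
    linear_combination this)
  have bzz : B (pdz uz) := sob huz.pdz pz.pdz zz zrz zzz zrzz
  obtain ⟨θrzz, -, -⟩ := lemB huθ.pdz pθ.pdz θzz
    ((((((((U.bmul brz θr).add (U.bmul br θrz)).add (U.bmul bzz θz)).add (U.bmul bz θzz)).add
      (U.bmul (i1.mul br) θz)).add (U.bmul (i1.mul bθ) rz)).add
      (U.bmul ((B.const (-1)).mul i1) θrz)).add (U.bmul i2 θz)) (fun r hr z => by
    have := lapz huθ (((((((hur.hz r z).mul (huθ.pdr.hz r z)).add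
      ((huz.hz r z).mul (huθ.pdz.hz r z))).add
      (((hur.hz r z).mul (huθ.hz r z)).const_mul r⁻¹)).sub ((huθ.pdr.hz r z).const_mul r⁻¹)).add
      ((huθ.hz r z).const_mul (r⁻¹ ^ 2)))) (fun t => lap_uθ heq hr t)
    rw [huθ.commf] at this ⊢
    linear_combination this)
  have bθz : B (pdz uθ) := sob huθ.pdz pθ.pdz θz θrz θzz θrzz
  obtain ⟨-, -, wrrz⟩ := lemB hw.pdz pw.pdz wzz
    (((((((((((U.bmul brz wr).add (U.bmul br wrz)).add (U.bmul bzz wz)).add (U.bmul bz wzz)).add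
      (U.bmul ((B.const (-1)).mul i1) wrz)).add (U.bmul i2 wz)).add
      (U.bmul (((B.const (-1)).mul i1).mul br) wz)).add
      (U.bmul (((B.const (-1)).mul i1).mul bw) rz))).add
      (U.bmul (((B.const (-2)).mul i1).mul bθz) θz)).add
      (U.bmul (((B.const (-2)).mul i1).mul bθ) θzz)) (fun r hr z => by
    have := lapz hw ((((((((hur.hz r z).mul (hw.pdr.hz r z)).add
      ((huz.hz r z).mul (hw.pdz.hz r z))).sub ((hw.pdr.hz r z).const_mul r⁻¹)).add
      ((hw.hz r z).const_mul (r⁻¹ ^ 2))).sub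
      (((hur.hz r z).mul (hw.hz r z)).const_mul r⁻¹)).sub
      ((((huθ.hz r z).mul (huθ.pdz.hz r z)).const_mul r⁻¹).const_mul 2)))
      (fun t => lap_w hur huθ huz hp heq hr t)
    rw [hw.commf] at this ⊢
    linear_combination this)
  have bwr : B (pdr (vort ur uz)) := by
    refine sob hw.pdr pw.pdr wr wrr ?_ ?_
    · rw [← hw.commf]; exact wrz
    · rw [← hw.commf]; exact wrrz
  refine ((((bwr.mul (B.const (-1))).add (((B.const (-1)).mul i1).mul bw)).add
    (((B.const (-1)).mul br).mul (brz.add ((B.const (-1)).mul bw)))).add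
    (((B.const (-1)).mul bz).mul bzz)).congr fun r hr z => ?_
  have e1 := lap_uz hur huz heq hr z
  have e2 := (heq r hr z trivial).2.2.1
  have e3 : vort ur uz r z = pdz ur r z - pdr uz r z := rfl
  linear_combination e2 + e1 + (r⁻¹ - ur r z) * e3

theorem I_bound {g : ℝ → ℝ → ℝ} {r K : ℝ} (h : ∀ z ∈ Set.Icc (-π) π, |g r z| ≤ K) :
    |I g r| ≤ 2 * π * K := by
  have := intervalIntegral.norm_integral_le_of_norm_le_const (a := -π) (b := π) (f := g r) (C := K)
    (fun x hx => by
      rw [Set.uIoc_of_le (by linarith [pi_pos])] at hx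
      exact h x ⟨hx.1.le, hx.2⟩)
  rw [show π - -π = 2 * π by ring, abs_of_pos (by positivity)] at this
  rw [mul_comm]
  exact this

theorem osc (hur : Sm ur) (huz : Sm uz) (huθ : Sm uθ) (hp : Sm p)
    (pr : Per ur) (pz : Per uz) (heq : ASNS ur uθ uz p Set.univ)
    {M C : ℝ} (hMr : ∀ r, 0 ≤ r → ∀ z, |ur r z| ≤ M) (hMθ : ∀ r, 0 ≤ r → ∀ z, |uθ r z| ≤ M)
    (hC : ∀ r, 0 ≤ r → ∀ z, |pdz p r z| ≤ C) :
    ∀ R : ℝ, 1 < R → ∀ r ∈ Set.Icc R (2 * R), ∀ z ∈ Set.Icc (-π) π,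
        |p r z - p R z| ≤ 3 * M ^ 2 + 4 * π * C := by
  intro R hR r hr z hz
  have hq : Sm (fun r z => p r z + (ur r z) ^ 2) := hp.add hur.sq
  set q : ℝ → ℝ → ℝ := fun r z => p r z + (ur r z) ^ 2 with hqdef
  have hT : Sm (fun r z => vort ur uz r z - uz r z * ur r z) := (vort_sm hur huz).sub (huz.mul hur)
  have pT : Per (fun r z => vort ur uz r z - uz r z * ur r z) := fun r z => by
    simp only [vort, pr.pdz r z, pz.pdr r z, pr r z, pz r z]
  have sqb : ∀ x : ℝ, |x| ≤ M → x ^ 2 ≤ M ^ 2 := fun x hx =>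
    sq_le_sq' (by linarith [(abs_le.1 hx).1]) (abs_le.1 hx).2
  have cr := hur.cont
  have cθ := huθ.cont
  have cT := hT.pdz.cont
  have hder : ∀ s, 0 < s → I (pdr q) s = s⁻¹ * I (fun r z => (uθ r z) ^ 2 - (ur r z) ^ 2) s := by
    intro s hs
    have e0 := I_pdz hT pT s
    have : I (pdr q) s = I (fun r z => s⁻¹ * ((uθ r z) ^ 2 - (ur r z) ^ 2)
        + pdz (fun r z => vort ur uz r z - uz r z * ur r z) r z) s := by
      unfold I
      congr 1
      funext t
      have d1 : pdr q s t = pdr p s t + 2 * ur s t * pdr ur s t := by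
        refine HasDerivAt.deriv (((hp.hr s t).add ((hur.hr s t).pow 2)).congr_deriv ?_)
        simp
      have d2 : pdz (fun r z => vort ur uz r z - uz r z * ur r z) s t =
          pdz (pdz ur) s t - pdz (pdr uz) s t - (pdz uz s t * ur s t + uz s t * pdz ur s t) :=
        HasDerivAt.deriv (((hur.pdz.hz s t).sub (huz.pdr.hz s t)).sub
          ((huz.hz s t).mul (hur.hz s t)))
      beta_reduce
      rw [d1, d2]
      have a1 := (heq s hs t trivial).1
      have a2 := div_r hur huz heq hs t
      have a3 := (heq s hs t trivial).2.2.2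
      linear_combination a1 + a2 + ur s t * a3
    rw [this, I_add (g := fun r z => s⁻¹ * ((uθ r z) ^ 2 - (ur r z) ^ 2)) (by fun_prop)
      (by fun_prop), e0, I_cmul]
    ring
  have hQ : |I q r - I q R| ≤ 2 * π * M ^ 2 := by
    have := Convex.norm_image_sub_le_of_norm_hasDerivWithin_le (f := I q) (f' := I (pdr q))
      (C := R⁻¹ * (2 * π * M ^ 2)) (s := Set.Icc R (2 * R)) (x := R) (y := r)
      (fun s _ => (I_deriv hq s).hasDerivWithinAt) (fun s hs => ?_) (convex_Icc _ _)
      ⟨le_rfl, by linarith⟩ hr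
    · rw [norm_eq_abs, norm_eq_abs, abs_of_nonneg (by linarith [hr.1] : 0 ≤ r - R)] at this
      refine this.trans ?_
      have k : r - R ≤ R := by linarith [hr.2]
      calc R⁻¹ * (2 * π * M ^ 2) * (r - R) ≤ R⁻¹ * (2 * π * M ^ 2) * R :=
            mul_le_mul_of_nonneg_left k (by positivity)
        _ = 2 * π * M ^ 2 := by field_simp
    · have s0 : 0 < s := by linarith [hs.1]
      rw [hder s s0, norm_eq_abs, abs_mul, abs_of_pos (inv_pos.2 s0)]
      refine mul_le_mul (inv_anti₀ (by linarith) hs.1) ?_ (abs_nonneg _) (by positivity)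
      refine I_bound fun t _ => ?_
      have := sqb _ (hMr s s0.le t)
      have := sqb _ (hMθ s s0.le t)
      rw [abs_le]
      constructor <;> nlinarith [sq_nonneg (ur s t), sq_nonneg (uθ s t)]
  have hu : ∀ s, 0 ≤ s → |I (fun r z => (ur r z) ^ 2) s| ≤ 2 * π * M ^ 2 := fun s hs =>
    I_bound fun t _ => by
      rw [abs_of_nonneg (sq_nonneg _)]
      exact sqb _ (hMr s hs t)
  have hqa : ∀ s, I q s = I p s + I (fun r z => (ur r z) ^ 2) s := fun s =>
    I_add hp.cont (sqc cr) s
  have hpa : ∀ s, 0 ≤ s → |I p s - 2 * π * p s z| ≤ 2 * π * (2 * π * C) := by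
    intro s hs
    have C0 : 0 ≤ C := (abs_nonneg _).trans (hC s hs z)
    have e : I p s - 2 * π * p s z = I (fun r t => p r t - p r z) s := by
      unfold I
      rw [intervalIntegral.integral_sub (ii hp.cont s _ _) intervalIntegrable_const]
      rw [intervalIntegral.integral_const, smul_eq_mul]; ring
    rw [e]
    refine I_bound fun t ht => ?_
    have := Convex.norm_image_sub_le_of_norm_hasDerivWithin_le (f := p s) (f' := pdz p s)
      (C := C) (s := Set.univ) (x := z) (y := t)
      (fun x _ => (hp.hz s x).hasDerivWithinAt) (fun x _ => hC s hs x) convex_univ trivial trivial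
    rw [norm_eq_abs, norm_eq_abs] at this
    have k : |t - z| ≤ 2 * π := by
      rw [abs_le]
      constructor <;> linarith [ht.1, ht.2, hz.1, hz.2]
    calc _ ≤ C * |t - z| := this
      _ ≤ C * (2 * π) := mul_le_mul_of_nonneg_left k C0
      _ = _ := by ring
  have R0 : (0:ℝ) ≤ R := by linarith
  have r0 : (0:ℝ) ≤ r := by linarith [hr.1]
  have a1 := abs_le.1 (hpa r r0)
  have a2 := abs_le.1 (hpa R R0)
  have a3 := abs_le.1 (hu r r0)
  have a4 := abs_le.1 (hu R R0)
  have a5 := abs_le.1 hQ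
  rw [hqa, hqa] at a5
  have fin : |2 * π * (p r z - p R z)| ≤ 2 * π * (3 * M ^ 2 + 4 * π * C) := by
    rw [abs_le]
    constructor <;> nlinarith
  rw [abs_mul, abs_of_pos (by positivity : 0 < 2 * π)] at fin
  exact le_of_mul_le_mul_left fin (by positivity)

end main

end PO

/-- For a smooth axially symmetric, `2π`-periodic-in-`z` D-solution of
ASNS on `ℝ³` with uniform decay at spatial infinity and finite Dirichlet integral,
`∂_z p` is bounded and the oscillation of `p` over dyadic annuli is bounded. -/
theorem pressure_oscillation_bounded
    (ur uθ uz p : ℝ → ℝ → ℝ)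
    (hur : ContDiff ℝ (⊤ : ℕ∞) (fun q : ℝ × ℝ => ur q.1 q.2))
    (huθ : ContDiff ℝ (⊤ : ℕ∞) (fun q : ℝ × ℝ => uθ q.1 q.2))
    (huz : ContDiff ℝ (⊤ : ℕ∞) (fun q : ℝ × ℝ => uz q.1 q.2))
    (hp : ContDiff ℝ (⊤ : ℕ∞) (fun q : ℝ × ℝ => p q.1 q.2))
    (hper : ∀ r z : ℝ, ur r (z + 2 * π) = ur r z ∧ uθ r (z + 2 * π) = uθ r z
      ∧ uz r (z + 2 * π) = uz r z ∧ p r (z + 2 * π) = p r z)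
    (heq : ASNS ur uθ uz p Set.univ)
    (hdecay : ∀ ε : ℝ, 0 < ε → ∃ R : ℝ, ∀ r : ℝ, R ≤ r → ∀ z : ℝ,
      |ur r z| + |uθ r z| + |uz r z| < ε)
    (hdir : ∫⁻ q in Set.Ioi (0:ℝ) ×ˢ Set.Icc (-π) π,
      ENNReal.ofReal (dirE ur uθ uz q.1 q.2 * q.1) < ⊤) :
    ∃ C : ℝ, (∀ r z : ℝ, 0 < r → |pdz p r z| ≤ C) ∧
      (∀ R : ℝ, 1 < R → ∀ r ∈ Set.Icc R (2 * R), ∀ z ∈ Set.Icc (-π) π,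
        |p r z - p R z| ≤ C) := by
  have sr : PO.Sm ur := hur
  have sθ : PO.Sm uθ := huθ
  have sz : PO.Sm uz := huz
  have sp : PO.Sm p := hp
  have pr : PO.Per ur := fun r z => (hper r z).1
  have pθ : PO.Per uθ := fun r z => (hper r z).2.1
  have pz : PO.Per uz := fun r z => (hper r z).2.2.1
  have pp : PO.Per p := fun r z => (hper r z).2.2.2
  obtain ⟨a, ha⟩ := hdecay 1 one_pos
  have br : PO.B ur := ⟨a, 1, fun r hr z => by
    have := ha r hr z
    linarith [abs_nonneg (ur r z), abs_nonneg (uθ r z), abs_nonneg (uz r z)]⟩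
  have bθ : PO.B uθ := ⟨a, 1, fun r hr z => by
    have := ha r hr z
    linarith [abs_nonneg (ur r z), abs_nonneg (uθ r z), abs_nonneg (uz r z)]⟩
  have bz : PO.B uz := ⟨a, 1, fun r hr z => by
    have := ha r hr z
    linarith [abs_nonneg (ur r z), abs_nonneg (uθ r z), abs_nonneg (uz r z)]⟩
  have hE : ∀ r z, 0 ≤ ((ur r z) ^ 2 + (uθ r z) ^ 2) / r ^ 2 := fun r z => by positivity
  have key : PO.B (pdz p) := by
    refine PO.pdz_bdd sr sθ sz sp pr pθ pz heq br bθ bz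
      (PO.dirU sr.pdr.cont ?_ hdir) (PO.dirU sr.pdz.cont ?_ hdir)
      (PO.dirU sθ.pdr.cont ?_ hdir) (PO.dirU sθ.pdz.cont ?_ hdir)
      (PO.dirU sz.pdr.cont ?_ hdir) (PO.dirU sz.pdz.cont ?_ hdir) <;>
    · intro r _ z
      unfold dirE
      linarith [hE r z, sq_nonneg (pdr ur r z), sq_nonneg (pdz ur r z), sq_nonneg (pdr uθ r z),
        sq_nonneg (pdz uθ r z), sq_nonneg (pdr uz r z), sq_nonneg (pdz uz r z)]
  obtain ⟨C, C0, hC⟩ := PO.B.glob sp.pdz.cont pp.pdz key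
  obtain ⟨M1, M10, hM1⟩ := PO.B.glob sr.cont pr br
  obtain ⟨M2, M20, hM2⟩ := PO.B.glob sθ.cont pθ bθ
  have hosc := PO.osc (M := max M1 M2) sr sz sθ sp pr pz heq
    (fun r hr z => (hM1 r hr z).trans (le_max_left _ _))
    (fun r hr z => (hM2 r hr z).trans (le_max_right _ _)) hC
  refine ⟨C + (3 * (max M1 M2) ^ 2 + 4 * π * C), fun r z hr => ?_, fun R hR r hr z hz => ?_⟩
  · have : 0 ≤ 3 * (max M1 M2) ^ 2 + 4 * π * C := by positivity
    linarith [hC r hr.le z]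
  · linarith [hosc R hR r hr z hz]
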